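/- There are no generic monodromy representations of B in S₇; that is, there is no group homomorphism φ: B → S₇ such that φ(σ) is a transposition and the image of φ is a transitive subgroup of S₇. -/

import Mathlib

/-- Generators of the braid group `B₂(C₂)` in Bellingeri's presentation. -/
inductive Gen : Type
  | a1 | a2 | b1 | b2 | s
  deriving DecidableEq

namespace Braid

open FreeGroup

abbrev A1 : FreeGroup Gen := FreeGroup.of Gen.a1
abbrev A2 : FreeGroup Gen := FreeGroup.of Gen.a2
abbrev B1 : FreeGroup Gen := FreeGroup.of Gen.b1
abbrev B2 : FreeGroup Gen := FreeGroup.of Gen.b2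
abbrev Sg : FreeGroup Gen := FreeGroup.of Gen.s

/-- The eleven relations (R2), (R3), (R4), (TR) of Bellingeri's presentation,
written as words that are set equal to `1`. -/
def rels : Set (FreeGroup Gen) :=
  { Sg⁻¹ * A1 * Sg⁻¹ * A1 * (A1 * Sg⁻¹ * A1 * Sg⁻¹)⁻¹,
    Sg⁻¹ * A2 * Sg⁻¹ * A2 * (A2 * Sg⁻¹ * A2 * Sg⁻¹)⁻¹,
    Sg⁻¹ * B1 * Sg⁻¹ * B1 * (B1 * Sg⁻¹ * B1 * Sg⁻¹)⁻¹,
    Sg⁻¹ * B2 * Sg⁻¹ * B2 * (B2 * Sg⁻¹ * B2 * Sg⁻¹)⁻¹,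
    Sg⁻¹ * A1 * Sg * A2 * (A2 * Sg⁻¹ * A1 * Sg)⁻¹,
    Sg⁻¹ * B1 * Sg * B2 * (B2 * Sg⁻¹ * B1 * Sg)⁻¹,
    Sg⁻¹ * A1 * Sg * B2 * (B2 * Sg⁻¹ * A1 * Sg)⁻¹,
    Sg⁻¹ * B1 * Sg * A2 * (A2 * Sg⁻¹ * B1 * Sg)⁻¹,
    Sg⁻¹ * A1 * Sg⁻¹ * B1 * (B1 * Sg⁻¹ * A1 * Sg)⁻¹,
    Sg⁻¹ * A2 * Sg⁻¹ * B2 * (B2 * Sg⁻¹ * A2 * Sg)⁻¹,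
    (A1 * B1⁻¹ * A1⁻¹ * B1) * (A2 * B2⁻¹ * A2⁻¹ * B2) * (Sg * Sg)⁻¹ }

/-- The group `B`, isomorphic to the braid group `B₂(C₂)` on two strings
on a genus `2` surface. -/
abbrev B : Type := PresentedGroup rels

/-- The image of the generator `σ` in `B`. -/
def σB : B := PresentedGroup.of Gen.s

/-- A generic monodromy representation of `B` in `Sₙ`: a homomorphism
`φ : B → Sₙ` such that `φ(σ)` is a transposition and the image of `φ` is a
transitive subgroup of `Sₙ`. -/
def IsGeneric (n : ℕ) (φ : B →* Equiv.Perm (Fin n)) : Prop :=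
  (φ σB).IsSwap ∧ ∀ i j : Fin n, ∃ g : B, φ g i = j

end Braid

open Braid

open Equiv

/-- If `x` commutes with the conjugate of `y` by an involution, so does `y` with that of `x`. -/
theorem commute_conj_symm {G : Type*} [Group G] {s x y : G} (hs : s * s = 1)
    (h : Commute (s * x * s) y) : Commute (s * y * s) x := by
  have key : ∀ z, s * (s * z) = z := fun z ↦ by rw [← mul_assoc, hs, one_mul]
  have hflip := congrArg (fun z ↦ s * z * s) h.eq
  simp only [mul_assoc, key, hs, mul_one] at hflip
  change _ = _
  simp only [mul_assoc]
  exact hflip.symm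

/-- If a generating set commutes with its conjugate by `s`, so does the subgroup it generates. -/
theorem commute_conj_of_mem_closure {G : Type*} [Group G] {s : G} (hs : s * s = 1) {S : Set G}
    (hS : ∀ x ∈ S, ∀ y ∈ S, Commute (s * x * s) y) {x y : G}
    (hx : x ∈ Subgroup.closure S) (hy : y ∈ Subgroup.closure S) : Commute (s * x * s) y := by
  have hinv : s⁻¹ = s := inv_eq_of_mul_eq_one_left hs
  have hconj : ∀ z, s * z * s = MulAut.conj s z := fun z ↦ by simp [hinv]
  simp only [hconj] at hS ⊢
  induction hx, hy using Subgroup.closure_induction₂ with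
  | mem x y hx hy => exact hS x hx y hy
  | one_left => simp
  | one_right => simp
  | mul_left x y z _ _ _ h₁ h₂ => rw [map_mul]; exact h₁.mul_left h₂
  | mul_right y z x _ _ _ h₁ h₂ => exact h₁.mul_right h₂
  | inv_left x y _ _ h => rw [map_inv]; exact h.inv_left
  | inv_right x y _ _ h => exact h.inv_right

/-- If `H` and its conjugate by the involution `s` commute, then `H ∪ s H s` is stable under
conjugation by `s` and by `H`. -/
theorem conj_mem_union_of_mem_closure {G : Type*} [Group G] {s : G} (hs : s * s = 1)
    {H : Subgroup G} (hH : ∀ x ∈ H, ∀ y ∈ H, Commute (s * x * s) y) {T : Set G}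
    (hT : ∀ t ∈ T, t = s ∨ t ∈ H) {g : G} (hg : g ∈ Subgroup.closure T) :
    ∀ x, (x ∈ H ∨ s * x * s ∈ H) → (g * x * g⁻¹ ∈ H ∨ s * (g * x * g⁻¹) * s ∈ H) := by
  have hinv : s⁻¹ = s := inv_eq_of_mul_eq_one_left hs
  have key : ∀ z, s * (s * z) = z := fun z ↦ by rw [← mul_assoc, hs, one_mul]
  have hS : ∀ x, (x ∈ H ∨ s * x * s ∈ H) → (s * x * s⁻¹ ∈ H ∨ s * (s * x * s⁻¹) * s ∈ H) := by
    intro x hx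
    rw [hinv, show s * (s * x * s) * s = x by simp only [mul_assoc, key, hs, mul_one]]
    exact hx.symm
  have hmem : ∀ y ∈ H, ∀ x, (x ∈ H ∨ s * x * s ∈ H) →
      (y * x * y⁻¹ ∈ H ∨ s * (y * x * y⁻¹) * s ∈ H) := by
    rintro y hy x (hx | hx)
    · exact .inl (mul_mem (mul_mem hy hx) (inv_mem hy))
    · have hc := hH _ hx y hy
      rw [show s * (s * x * s) * s = x by simp only [mul_assoc, key, hs, mul_one]] at hc
      rw [hc.symm.eq, mul_inv_cancel_right]
      exact .inr hx
  induction hg using Subgroup.closure_induction'' with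
  | mem t ht =>
    obtain rfl | h := hT t ht
    · exact hS
    · exact hmem t h
  | inv_mem t ht =>
    obtain rfl | h := hT t ht
    · rw [hinv]; exact hS
    · exact hmem _ (inv_mem h)
  | one => simp
  | mul a b _ _ ha hb =>
    intro x hx
    simpa only [mul_inv_rev, mul_assoc] using ha _ (hb x hx)

/-- On an odd number of at least five letters, a permutation commuting with all its conjugates by
transpositions is trivial. -/
theorem eq_one_of_commute_swap_conj {α : Type*} [Fintype α] [DecidableEq α]
    (hodd : ¬ 2 ∣ Fintype.card α) (hcard : 5 ≤ Fintype.card α) {h : Perm α}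
    (hh : ∀ p r : α, p ≠ r → Commute (swap p r * h * swap p r) h) : h = 1 := by
  have key : ∀ p r : α, p ≠ r → h p ≠ r → h p ≠ p →
      swap p r (h (swap p r (h r))) = h (h p) := by
    intro p r h₁ h₂ h₃
    have := DFunLike.congr_fun (hh p r h₁).eq r
    simpa [swap_apply_of_ne_of_ne h₃ h₂] using this
  by_contra hne
  by_cases h2 : h * h = 1
  · have hhh : ∀ a, h (h a) = a := fun a ↦ by simpa using DFunLike.congr_fun h2 a
    obtain ⟨r, hr⟩ := Perm.exists_fixed_point_of_prime (p := 2) (n := 1) hodd (σ := h)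
      (by rw [pow_one, pow_two, h2])
    obtain ⟨p, hp⟩ : ∃ p, h p ≠ p := by
      by_contra! hall
      exact hne (Perm.ext hall)
    have hpr : p ≠ r := fun e ↦ hp (e ▸ hr)
    have hqr : h p ≠ r := fun e ↦ hpr (h.injective (e.trans hr.symm))
    have := key p r hpr hqr hp
    rw [hr, swap_apply_right, hhh, swap_apply_of_ne_of_ne hp hqr] at this
    exact hp this
  · obtain ⟨p, hp⟩ : ∃ p, h (h p) ≠ p := by
      by_contra! hall
      exact h2 (Perm.ext hall)
    have hq : h p ≠ p := fun e ↦ hp (by rw [e, e])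
    obtain ⟨r, hr⟩ : ∃ r, r ∉ ({p, h p, h (h p), h.symm p} : Finset α) := by
      by_contra! hall
      have := Finset.card_le_card (fun a _ ↦ hall a : Finset.univ ⊆ _)
      have := this.trans Finset.card_le_four
      rw [Finset.card_univ] at this
      omega
    simp only [Finset.mem_insert, Finset.mem_singleton, not_or] at hr
    obtain ⟨hrp, hrq, hrqq, hrs⟩ := hr
    have hhr : h r ≠ p := fun e ↦ hrs (by rw [← e, symm_apply_apply])
    have hk := key p r (Ne.symm hrp) (Ne.symm hrq) hq
    by_cases hfix : h r = r
    · rw [hfix, swap_apply_right, swap_apply_of_ne_of_ne hq (Ne.symm hrq)] at hk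
      exact hq (h.injective hk).symm
    · rw [swap_apply_of_ne_of_ne hhr hfix, swap_apply_eq_iff,
        swap_apply_of_ne_of_ne hp (Ne.symm hrqq)] at hk
      exact hrp (h.injective (h.injective hk))

/-- There are no generic monodromy representations of B in S₇. -/
theorem stmt11 : ¬ ∃ φ : B →* Equiv.Perm (Fin 7), IsGeneric 7 φ := by
  classical
  rintro ⟨φ, hswap, htrans⟩
  set s := φ σB with hsdef
  set f : Gen → Perm (Fin 7) := fun i ↦ φ (PresentedGroup.of i) with hf
  have hfs : f Gen.s = s := rfl
  have hs : s * s = 1 := by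
    obtain ⟨x, y, -, h⟩ := hswap
    rw [h, swap_mul_self]
  have hinv : s⁻¹ = s := inv_eq_of_mul_eq_one_left hs
  have hrel : ∀ w ∈ rels, FreeGroup.lift f w = 1 := by
    intro w hw
    have : FreeGroup.lift f w = φ (PresentedGroup.mk rels w) :=
      (FreeGroup.lift_unique (φ.comp (PresentedGroup.mk rels)) fun _ ↦ rfl).symm
    rw [this, PresentedGroup.one_of_mem hw, map_one]
  simp only [rels, Set.mem_insert_iff, Set.mem_singleton_iff, forall_eq_or_imp, forall_eq,
    map_mul, map_inv, FreeGroup.lift_apply_of, hfs, hinv, mul_inv_eq_one] at hrel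
  obtain ⟨ha1, ha2, hb1, hb2, ha1a2, hb1b2, ha1b2, hb1a2, ha1b1, ha2b2, -⟩ := hrel
  set S : Set (Perm (Fin 7)) := Set.image f {i | i ≠ Gen.s}
  have hS : ∀ x ∈ S, ∀ y ∈ S, Commute (s * x * s) y := by
    have h11 : Commute (s * f .a1 * s) (f .a1) := by
      simpa [mul_assoc, Commute, SemiconjBy] using ha1
    have h22 : Commute (s * f .a2 * s) (f .a2) := by
      simpa [mul_assoc, Commute, SemiconjBy] using ha2
    have h33 : Commute (s * f .b1 * s) (f .b1) := by
      simpa [mul_assoc, Commute, SemiconjBy] using hb1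
    have h44 : Commute (s * f .b2 * s) (f .b2) := by
      simpa [mul_assoc, Commute, SemiconjBy] using hb2
    have h12 : Commute (s * f .a1 * s) (f .a2) := by
      simpa [mul_assoc, Commute, SemiconjBy] using ha1a2
    have h34 : Commute (s * f .b1 * s) (f .b2) := by
      simpa [mul_assoc, Commute, SemiconjBy] using hb1b2
    have h14 : Commute (s * f .a1 * s) (f .b2) := by
      simpa [mul_assoc, Commute, SemiconjBy] using ha1b2
    have h32 : Commute (s * f .b1 * s) (f .a2) := by
      simpa [mul_assoc, Commute, SemiconjBy] using hb1a2
    have h13 : Commute (s * f .a1 * s) (f .b1) := by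
      simpa [mul_assoc, Commute, SemiconjBy] using ha1b1
    have h24 : Commute (s * f .a2 * s) (f .b2) := by
      simpa [mul_assoc, Commute, SemiconjBy] using ha2b2
    rintro _ ⟨i, hi, rfl⟩ _ ⟨j, hj, rfl⟩
    cases i <;> cases j <;>
      first | exact absurd rfl hi | exact absurd rfl hj | assumption |
        exact commute_conj_symm hs ‹_›
  have hH : ∀ x ∈ Subgroup.closure S, ∀ y ∈ Subgroup.closure S, Commute (s * x * s) y :=
    fun x hx y hy ↦ commute_conj_of_mem_closure hs hS hx hy
  have hgen : φ.range = Subgroup.closure (Set.range f) := by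
    rw [MonoidHom.range_eq_map, ← PresentedGroup.closure_range_of, MonoidHom.map_closure,
      ← Set.range_comp]
    rfl
  have htop : φ.range = ⊤ := by
    have : MulAction.IsPretransitive φ.range (Fin 7) :=
      ⟨fun i j ↦ (htrans i j).imp' (fun g ↦ ⟨φ g, g, rfl⟩) fun _ h ↦ h⟩
    refine Perm.subgroup_eq_top_of_swap_mem (by norm_num) ?_ ⟨σB, rfl⟩ hswap
    rw [← Nat.card_eq_fintype_card, ← Nat.card_eq_fintype_card,
      ← MulAction.index_stabilizer_of_transitive φ.range (0 : Fin 7)]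
    exact Subgroup.index_dvd_card _
  have hconj : ∀ g, ∀ h ∈ Subgroup.closure S,
      Commute (s * (g * h * g⁻¹) * s) (g * h * g⁻¹) := by
    intro g h hh
    have hg : g ∈ Subgroup.closure (Set.range f) := hgen ▸ htop ▸ Subgroup.mem_top g
    have hT : ∀ t ∈ Set.range f, t = s ∨ t ∈ Subgroup.closure S := by
      rintro _ ⟨i, rfl⟩
      by_cases hi : i = Gen.s
      · exact .inl (hi ▸ rfl)
      · exact .inr (Subgroup.subset_closure ⟨i, hi, rfl⟩)
    obtain hx | hx := conj_mem_union_of_mem_closure hs hH hT hg h (.inl hh)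
    · exact hH _ hx _ hx
    · have hc := hH _ hx _ hx
      have key : ∀ z, s * (s * z) = z := fun z ↦ by rw [← mul_assoc, hs, one_mul]
      rw [show ∀ z, s * (s * z * s) * s = z from
        fun z ↦ by simp only [mul_assoc, key, hs, mul_one]] at hc
      exact hc.symm
  have htriv : ∀ h ∈ Subgroup.closure S, h = 1 := by
    intro h hh
    refine eq_one_of_commute_swap_conj (by simp) (by simp) fun p r hpr ↦ ?_
    obtain ⟨x, y, hxy, hsxy⟩ := hswap
    obtain ⟨g, hg⟩ := isConj_iff.1 (Perm.isConj_swap hxy hpr)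
    rw [← hsxy] at hg
    have := (hconj g⁻¹ h hh).map (MulAut.conj g)
    rw [← hg]
    simpa [mul_assoc, hinv] using this
  obtain ⟨x, y, hxy, hsxy⟩ := hswap
  obtain ⟨z, hz⟩ : ∃ z, z ∉ ({x, y} : Finset (Fin 7)) := by
    by_contra! hall
    have := (Finset.card_le_card (fun a _ ↦ hall a : Finset.univ ⊆ _)).trans Finset.card_le_two
    simp at this
  simp only [Finset.mem_insert, Finset.mem_singleton, not_or] at hz
  have hle : φ.range ≤ MulAction.stabilizer (Perm (Fin 7)) z := by
    rw [hgen, Subgroup.closure_le]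
    rintro _ ⟨i, rfl⟩
    by_cases hi : i = Gen.s
    · rw [hi, hfs, hsxy]
      exact swap_apply_of_ne_of_ne hz.1 hz.2
    · rw [htriv _ (Subgroup.subset_closure ⟨i, hi, rfl⟩)]
      exact one_mem _
  obtain ⟨g, hg⟩ := htrans z x
  exact hz.1 ((hle ⟨g, rfl⟩ : φ g z = z).symm.trans hg)
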